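/- arXiv:2107.14718 — 3 statements merged into one kernel-verified Lean document; each statement's English description precedes it below -/
import Mathlib

section
/- There exists a branchwise-real tree order that admits no strictly monotonic map into ℝ; in particular, there is a branchwise-real tree order with no continuous grading. -/
/-- A partial order is rooted if it has a minimum element. -/
def IsRooted (X : Type*) [PartialOrder X] : Prop := ∃ r : X, ∀ x, r ≤ x

/-- The set of predecessors of every element is linearly ordered. -/
def DownLinear (X : Type*) [PartialOrder X] : Prop :=
  ∀ x y z : X, y ≤ x → z ≤ x → y ≤ z ∨ z ≤ y

/-- A well-stratified tree: a rooted partial order in which the set of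
predecessors of every element is well-ordered. -/
def IsWSTree (T : Type*) [PartialOrder T] : Prop :=
  IsRooted T ∧ DownLinear T ∧ ∀ x : T, (Set.Iio x).IsWF

/-- A branchwise-real tree order: a rooted partial order with linearly
ordered predecessor sets, in which every branch (maximal chain) is
order-isomorphic to a real interval, and any two elements have a meet. -/
def IsBRTO (X : Type*) [PartialOrder X] : Prop :=
  IsRooted X ∧ DownLinear X ∧
  (∀ B : Set X, IsMaxChain (· ≤ ·) B →
      ∃ I : Set ℝ, I.OrdConnected ∧ Nonempty (B ≃o I)) ∧
  (∀ x y : X, ∃ m : X, IsGLB {x, y} m)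

/-- A continuous grading: a strictly monotonic real-valued map restricting
to an order isomorphism `[x,y] → [ℓ x, ℓ y]` for all `x < y` (these intervals
are chains, so a strictly monotonic bijection between them is an order
isomorphism). -/
def IsContinuousGrading {X : Type*} [PartialOrder X] (ℓ : X → ℝ) : Prop :=
  StrictMono ℓ ∧ ∀ x y : X, x < y →
    Set.BijOn ℓ (Set.Icc x y) (Set.Icc (ℓ x) (ℓ y))

open Set Function

/-- A well-ordered set of reals is countable. -/
theorem Set.IsWF.countable_real {s : Set ℝ} (hs : s.IsWF) : s.Countable := by
  classical
  let y : ℝ → ℝ := fun x ↦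
    if h : (s ∩ Ioi x).Nonempty then (hs.mono inter_subset_left).min h else x + 1
  have hle : ∀ x, ∀ z ∈ s, x < z → y x ≤ z := by
    intro x z hz hxz
    have h : (s ∩ Ioi x).Nonempty := ⟨z, hz, hxz⟩
    simp only [y, dif_pos h]
    exact (hs.mono inter_subset_left).min_le h ⟨hz, hxz⟩
  refine PairwiseDisjoint.countable_of_Ioo (y := y) ?_ ?_
  · intro a ha b hb hab
    refine Set.disjoint_left.2 fun z hza hzb ↦ ?_
    rcases lt_or_gt_of_ne hab with h | h
    · exact absurd (hle a b hb h) (not_le.2 (hzb.1.trans hza.2))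
    · exact absurd (hle b a ha h) (not_le.2 (hza.1.trans hzb.2))
  · intro x _
    by_cases h : (s ∩ Ioi x).Nonempty
    · simp only [y, dif_pos h]
      exact ((hs.mono inter_subset_left).min_mem h).2
    · simp only [y, dif_neg h]
      exact lt_add_one x

/-- Functions from the reals to the unit interval with well-ordered support. -/
@[ext]
structure Profile : Type 1 where
  /-- The underlying function. -/
  val : ℝ → ℝ
  nonneg : ∀ a, 0 ≤ val a
  le_one : ∀ a, val a ≤ 1
  isWF : (support val).IsWF

namespace Profile

/-- `u ≤ v` when `u` is obtained from `v` by keeping the values before some point, lowering the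
value at that point, and replacing all later values by zero. -/
instance : PartialOrder Profile where
  le u v := ∀ a, u.val a ≤ v.val a ∧ (u.val a ≠ v.val a → ∀ b, a < b → u.val b = 0)
  le_refl u a := ⟨le_rfl, fun h ↦ absurd rfl h⟩
  le_trans u v w huv hvw a := by
    refine ⟨(huv a).1.trans (hvw a).1, fun h b hb ↦ ?_⟩
    by_cases h1 : u.val a = v.val a
    · exact le_antisymm ((huv b).1.trans_eq ((hvw a).2 (h1 ▸ h) b hb)) (u.nonneg b)
    · exact (huv a).2 h1 b hb
  le_antisymm u v huv hvu := Profile.ext (funext fun a ↦ le_antisymm (huv a).1 (hvu a).1)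

theorem val_mem_Icc (u : Profile) (a : ℝ) : u.val a ∈ Icc (0 : ℝ) 1 :=
  mem_Icc.2 ⟨u.nonneg a, u.le_one a⟩

theorem le_of_eq_below {u v : Profile} {a : ℝ} (hlt : ∀ b < a, u.val b = v.val b)
    (ha : u.val a ≤ v.val a) (hgt : ∀ b, a < b → u.val b = 0) : u ≤ v := by
  intro b
  rcases lt_trichotomy b a with h | rfl | h
  · exact ⟨(hlt b h).le, fun h' ↦ absurd (hlt b h) h'⟩
  · exact ⟨ha, fun _ ↦ hgt⟩
  · exact ⟨(hgt b h).trans_le (v.nonneg b), fun _ d hd ↦ hgt d (h.trans hd)⟩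

theorem exists_first_ne {u v : Profile} (h : u ≠ v) :
    ∃ a, u.val a ≠ v.val a ∧ ∀ b < a, u.val b = v.val b := by
  have hne : {a | u.val a ≠ v.val a}.Nonempty := by
    by_contra hemp
    refine h (Profile.ext (funext fun a ↦ ?_))
    by_contra ha
    exact hemp ⟨a, ha⟩
  have hwf : {a | u.val a ≠ v.val a}.IsWF := by
    refine (u.isWF.union v.isWF).mono fun a ha ↦ ?_
    by_contra hc
    simp only [mem_union, mem_support, not_or, not_not] at hc
    exact ha (hc.1.trans hc.2.symm)
  refine ⟨hwf.min hne, hwf.min_mem hne, fun b hb ↦ ?_⟩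
  by_contra hc
  exact hwf.not_lt_min hne hc hb

/-- Keep the values before `a`, take the value `t` at `a`, and zero afterwards. -/
noncomputable def trunc (u : Profile) (a t : ℝ) (ht : t ∈ Icc (0 : ℝ) 1) : Profile where
  val b := if b < a then u.val b else if b = a then t else 0
  nonneg b := by
    split_ifs
    exacts [u.nonneg b, ht.1, le_rfl]
  le_one b := by
    split_ifs
    exacts [u.le_one b, ht.2, zero_le_one]
  isWF := by
    refine (u.isWF.insert a).mono fun b hb ↦ ?_
    by_cases h : b = a
    · exact Or.inl h
    · by_cases h' : b < a
      · right
        simpa [h'] using hb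
      · simp [h, h'] at hb

section trunc

variable (u : Profile) {a b t : ℝ} (ht : t ∈ Icc (0 : ℝ) 1)

theorem trunc_of_lt (h : b < a) : (u.trunc a t ht).val b = u.val b := by simp [trunc, h]

theorem trunc_self : (u.trunc a t ht).val a = t := by simp [trunc]

theorem trunc_of_gt (h : a < b) : (u.trunc a t ht).val b = 0 := by
  simp [trunc, h.not_gt, h.ne']

theorem trunc_le (h : t ≤ u.val a) : u.trunc a t ht ≤ u :=
  le_of_eq_below (fun _ hb ↦ u.trunc_of_lt ht hb) ((u.trunc_self ht).trans_le h)
    fun _ hb ↦ u.trunc_of_gt ht hb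

end trunc

theorem isRooted : IsRooted Profile := by
  refine ⟨⟨0, fun _ ↦ le_rfl, fun _ ↦ zero_le_one, by simp⟩, fun x a ↦ ?_⟩
  exact ⟨x.nonneg a, fun _ _ _ ↦ rfl⟩

theorem downLinear : DownLinear Profile := by
  intro x y z hy hz
  by_cases h : y = z
  · exact Or.inl h.le
  obtain ⟨a, ha, hlt⟩ := exists_first_ne h
  rcases lt_or_gt_of_ne ha with h' | h'
  · exact Or.inl (le_of_eq_below hlt h'.le ((hy a).2 (h'.trans_le (hz a).1).ne))
  · exact Or.inr (le_of_eq_below (fun b hb ↦ (hlt b hb).symm) h'.le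
      ((hz a).2 (h'.trans_le (hy a).1).ne))

theorem exists_isGLB (x y : Profile) : ∃ m, IsGLB {x, y} m := by
  by_cases h : x = y
  · exact ⟨x, by simp [h]⟩
  obtain ⟨a, ha, hlt⟩ := exists_first_ne h
  wlog hxy : x.val a < y.val a generalizing x y
  · rw [pair_comm]
    exact this y x (Ne.symm h) ha.symm (fun b hb ↦ (hlt b hb).symm)
      (lt_of_le_of_ne (not_lt.1 hxy) ha.symm)
  refine ⟨x.trunc a (x.val a) (x.val_mem_Icc a), ?_, ?_⟩
  · simp only [mem_lowerBounds, mem_insert_iff, mem_singleton_iff, forall_eq_or_imp, forall_eq]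
    refine ⟨x.trunc_le _ le_rfl, le_of_eq_below (a := a) (fun b hb ↦ ?_) ?_
      fun b hb ↦ x.trunc_of_gt _ hb⟩
    · rw [trunc_of_lt _ _ hb, hlt b hb]
    · rw [trunc_self]
      exact hxy.le
  · intro n hn
    simp only [mem_lowerBounds, mem_insert_iff, mem_singleton_iff, forall_eq_or_imp,
      forall_eq] at hn
    obtain ⟨hnx, hny⟩ := hn
    have hzero : ∀ b, a < b → n.val b = 0 := (hny a).2 ((hnx a).1.trans_lt hxy).ne
    intro b
    rcases lt_trichotomy b a with hb | rfl | hb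
    · rw [trunc_of_lt _ _ hb]
      exact hnx b
    · rw [trunc_self]
      exact hnx b
    · rw [trunc_of_gt _ _ hb]
      exact ⟨(hzero b hb).le, fun _ d hd ↦ hzero d (hb.trans hd)⟩

/-- The sum of the values of a profile with weights `c`. -/
noncomputable def weightedSum (c : ℝ → ℝ) (u : Profile) : ℝ := ∑' a, u.val a * c a

section weightedSum

variable {c : ℝ → ℝ}

theorem summable_mul (hc : ∀ a, 0 ≤ c a) (hs : Summable c) (u : Profile) :
    Summable fun a ↦ u.val a * c a :=
  hs.of_nonneg_of_le (fun a ↦ mul_nonneg (u.nonneg a) (hc a))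
    fun a ↦ mul_le_of_le_one_left (hc a) (u.le_one a)

theorem weightedSum_nonneg (hc : ∀ a, 0 ≤ c a) (u : Profile) : 0 ≤ weightedSum c u :=
  tsum_nonneg fun a ↦ mul_nonneg (u.nonneg a) (hc a)

theorem weightedSum_mono (hc : ∀ a, 0 ≤ c a) (hs : Summable c) : Monotone (weightedSum c) :=
  fun u v h ↦ (summable_mul hc hs u).tsum_le_tsum
    (fun a ↦ mul_le_mul_of_nonneg_right (h a).1 (hc a)) (summable_mul hc hs v)

theorem weightedSum_lt (hc : ∀ a, 0 ≤ c a) (hs : Summable c) {u v : Profile} (h : u < v)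
    (hv : ∀ a ∈ support v.val, 0 < c a) : weightedSum c u < weightedSum c v := by
  obtain ⟨a, ha, -⟩ := exists_first_ne h.ne
  have hlt : u.val a < v.val a := lt_of_le_of_ne (h.le a).1 ha
  have hca : 0 < c a := hv a ((u.nonneg a).trans_lt hlt).ne'
  exact Summable.tsum_lt_tsum (fun b ↦ mul_le_mul_of_nonneg_right (h.le b).1 (hc b))
    (mul_lt_mul_of_pos_right hlt hca) (summable_mul hc hs u) (summable_mul hc hs v)

theorem weightedSum_le_of_trunc_le (hc : ∀ a, 0 ≤ c a) (hs : Summable c) {u : Profile} {y : ℝ}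
    (hy : 0 ≤ y)
    (h : ∀ a ∈ support u.val, weightedSum c (u.trunc a (u.val a) (u.val_mem_Icc a)) ≤ y) :
    weightedSum c u ≤ y := by
  classical
  refine (summable_mul hc hs u).tsum_le_of_sum_le fun F ↦ ?_
  rw [← Finset.sum_filter_of_ne (p := fun a ↦ u.val a ≠ 0) fun a _ ha ↦ left_ne_zero_of_mul ha]
  rcases (F.filter fun a ↦ u.val a ≠ 0).eq_empty_or_nonempty with he | hne
  · rw [he, Finset.sum_empty]
    exact hy
  · set m := (F.filter fun a ↦ u.val a ≠ 0).max' hne with hm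
    have hmem := Finset.max'_mem _ hne
    rw [Finset.mem_filter] at hmem
    refine le_trans (le_of_eq ?_) (((summable_mul hc hs
      (u.trunc m (u.val m) (u.val_mem_Icc m))).sum_le_tsum (F.filter fun a ↦ u.val a ≠ 0)
      fun a _ ↦ mul_nonneg (nonneg _ a) (hc a)).trans (h m hmem.2))
    refine Finset.sum_congr rfl fun a ha ↦ ?_
    rcases (Finset.le_max' _ a ha).lt_or_eq with h' | h'
    · rw [trunc_of_lt _ _ h']
    · rw [← hm] at h'
      rw [h', trunc_self]

theorem weightedSum_trunc (hc : ∀ a, 0 ≤ c a) (hs : Summable c) (u : Profile) {a t : ℝ}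
    (ht : t ∈ Icc (0 : ℝ) 1) :
    weightedSum c (u.trunc a t ht) =
      weightedSum c (u.trunc a 0 (left_mem_Icc.2 zero_le_one)) + t * c a := by
  classical
  have h : ∀ b, (u.trunc a t ht).val b * c b =
      (u.trunc a 0 (left_mem_Icc.2 zero_le_one)).val b * c b + (Pi.single a (t * c a) : ℝ → ℝ) b := by
    intro b
    rcases lt_trichotomy b a with hb | rfl | hb
    · simp [trunc_of_lt _ _ hb, hb.ne]
    · simp [trunc_self]
    · simp [trunc_of_gt _ _ hb, hb.ne']
  unfold weightedSum
  rw [tsum_congr h, (summable_mul hc hs _).tsum_add (hasSum_pi_single a (t * c a)).summable,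
    tsum_pi_single]

theorem exists_le_weightedSum_eq (hc : ∀ a, 0 ≤ c a) (hs : Summable c) {u : Profile}
    (hu : ∀ a ∈ support u.val, 0 < c a) {y : ℝ} (hy : 0 ≤ y) (hyu : y ≤ weightedSum c u) :
    ∃ v ≤ u, weightedSum c v = y := by
  let S : Set ℝ :=
    {a ∈ support u.val | y ≤ weightedSum c (u.trunc a (u.val a) (u.val_mem_Icc a))}
  have hS : S.IsWF := u.isWF.mono (sep_subset _ _)
  rcases S.eq_empty_or_nonempty with he | hne
  · refine ⟨u, le_rfl, le_antisymm (weightedSum_le_of_trunc_le hc hs hy fun a ha ↦ ?_) hyu⟩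
    by_contra hlt
    exact (eq_empty_iff_forall_notMem.1 he a) ⟨ha, (not_le.1 hlt).le⟩
  obtain ⟨a, ⟨ha, hya⟩, hmin⟩ : ∃ a ∈ S, ∀ b < a, b ∉ S :=
    ⟨hS.min hne, hS.min_mem hne, fun b hb hbS ↦ hS.not_lt_min hne hbS hb⟩
  have hca : 0 < c a := hu a ha
  have hL : weightedSum c (u.trunc a 0 (left_mem_Icc.2 zero_le_one)) ≤ y := by
    refine weightedSum_le_of_trunc_le hc hs hy fun b hb ↦ ?_
    have hba : b < a := by
      by_contra hge
      rcases (not_lt.1 hge).eq_or_lt with rfl | h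
      · exact hb (trunc_self _ _)
      · exact hb (trunc_of_gt _ _ h)
    have hbu : u.val b ≠ 0 := by
      rwa [mem_support, trunc_of_lt _ _ hba] at hb
    refine le_trans (weightedSum_mono hc hs ?_)
      (not_le.1 fun hle ↦ hmin b hba ⟨hbu, hle⟩).le
    refine le_of_eq_below (a := b) (fun d hd ↦ ?_) ?_ fun d hd ↦ trunc_of_gt _ _ hd
    · rw [trunc_of_lt _ _ hd, trunc_of_lt _ _ hd, trunc_of_lt _ _ (hd.trans hba)]
    · rw [trunc_self, trunc_self, trunc_of_lt _ _ hba]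
  rw [weightedSum_trunc hc hs] at hya
  have ht0 : 0 ≤ (y - weightedSum c (u.trunc a 0 (left_mem_Icc.2 zero_le_one))) / c a :=
    div_nonneg (sub_nonneg.2 hL) hca.le
  have htu : (y - weightedSum c (u.trunc a 0 (left_mem_Icc.2 zero_le_one))) / c a ≤ u.val a := by
    rw [div_le_iff₀ hca]
    linarith
  refine ⟨u.trunc a _ (mem_Icc.2 ⟨ht0, htu.trans (u.le_one a)⟩), u.trunc_le _ htu, ?_⟩
  rw [weightedSum_trunc hc hs, div_mul_cancel₀ _ hca.ne']
  ring

end weightedSum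

theorem isWF_iUnion_support_of_isChain {B : Set Profile} (hB : IsChain (· ≤ ·) B) :
    (⋃ u ∈ B, support u.val).IsWF := by
  rw [isWF_iff_no_descending_seq]
  intro f hf hmem
  obtain ⟨u, hu, h0⟩ := mem_iUnion₂.1 (hmem 0)
  refine isWF_iff_no_descending_seq.1 u.isWF f hf fun n ↦ ?_
  rcases n.eq_zero_or_pos with rfl | hn
  · exact h0
  obtain ⟨v, hv, hvn⟩ := mem_iUnion₂.1 (hmem n)
  rcases hB.total hu hv with h | h
  · by_contra hun
    refine h0 ((h (f n)).2 (fun he ↦ hvn ?_) (f 0) (hf hn))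
    rw [← he]
    exact notMem_support.1 hun
  · exact ((lt_of_le_of_ne (v.nonneg _) (Ne.symm hvn)).trans_le (h (f n)).1).ne'

theorem isLowerSet_of_isMaxChain {B : Set Profile} (hB : IsMaxChain (· ≤ ·) B) :
    IsLowerSet B := by
  intro v u huv hv
  have hins : IsChain (· ≤ ·) (insert u B) := by
    refine hB.1.insert fun b hb _ ↦ ?_
    rcases hB.1.total hb hv with h | h
    · exact downLinear v u b huv h
    · exact Or.inl (huv.trans h)
  rw [hB.2 hins (subset_insert u B)]
  exact mem_insert u B

theorem exists_orderIso_of_isMaxChain {B : Set Profile} (hB : IsMaxChain (· ≤ ·) B) :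
    ∃ I : Set ℝ, I.OrdConnected ∧ Nonempty (B ≃o I) := by
  classical
  obtain ⟨e, he, s, hs, -⟩ :=
    (isWF_iUnion_support_of_isChain hB.1).countable_real.exists_pos_hasSum_le one_pos
  set W : Set ℝ := ⋃ u ∈ B, support u.val
  set c : ℝ → ℝ := W.indicator e with hcdef
  have hc : ∀ a, 0 ≤ c a := fun a ↦ indicator_nonneg (fun a _ ↦ (he a).le) a
  have hsum : Summable c := summable_subtype_iff_indicator.1 hs.summable
  have hpos : ∀ u ∈ B, ∀ a ∈ support u.val, 0 < c a := by
    intro u hu a ha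
    rw [hcdef, indicator_of_mem (mem_iUnion₂.2 ⟨u, hu, ha⟩)]
    exact he a
  have hle : ∀ u ∈ B, ∀ v ∈ B, weightedSum c u ≤ weightedSum c v → u ≤ v := by
    intro u hu v hv h
    rcases hB.1.total hu hv with h' | h'
    · exact h'
    · by_contra hnot
      exact (weightedSum_lt hc hsum (lt_of_le_not_ge h' hnot) (hpos u hu)).not_ge h
  have hinj : InjOn (weightedSum c) B := fun u hu v hv h ↦
    le_antisymm (hle u hu v hv h.le) (hle v hv u hu h.ge)
  refine ⟨weightedSum c '' B, ⟨?_⟩, ⟨⟨Equiv.Set.imageOfInjOn _ B hinj, ?_⟩⟩⟩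
  · rintro _ ⟨u, hu, rfl⟩ _ ⟨v, hv, rfl⟩ y ⟨hy, hyv⟩
    obtain ⟨w, hwv, rfl⟩ := exists_le_weightedSum_eq hc hsum (hpos v hv)
      ((weightedSum_nonneg hc u).trans hy) hyv
    exact ⟨w, isLowerSet_of_isMaxChain hB hwv hv, rfl⟩
  · rintro ⟨u, hu⟩ ⟨v, hv⟩
    exact ⟨fun h ↦ hle u hu v hv h, fun h ↦ weightedSum_mono hc hsum h⟩

theorem isBRTO : IsBRTO Profile :=
  ⟨isRooted, downLinear, fun _ ↦ exists_orderIso_of_isMaxChain, exists_isGLB⟩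

/-- The characteristic function of a well-ordered set. -/
noncomputable def ofSet (s : Set ℝ) (hs : s.IsWF) : Profile where
  val := s.indicator 1
  nonneg := indicator_nonneg fun _ _ ↦ zero_le_one
  le_one := indicator_le_self' (fun _ _ ↦ zero_le_one)
  isWF := hs.mono support_indicator_subset

theorem ofSet_lt_ofSet {s t : Set ℝ} (hs : s.IsWF) (ht : t.IsWF) (hst : s ⊆ t) {m : ℝ}
    (hm : m ∈ t) (hlt : ∀ a ∈ s, a < m) (hinit : ∀ a ∈ t, a < m → a ∈ s) :
    ofSet s hs < ofSet t ht := by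
  have hms : m ∉ s := fun h ↦ (hlt m h).false
  refine lt_of_le_of_ne (le_of_eq_below (a := m) (fun b hb ↦ ?_) ?_ fun b hb ↦ ?_) fun h ↦ ?_
  · by_cases hbs : b ∈ s
    · simp [ofSet, hbs, hst hbs]
    · have hbt : b ∉ t := fun h ↦ hbs (hinit b h hb)
      simp [ofSet, hbs, hbt]
  · simp [ofSet, hms, hm]
  · have hbs : b ∉ s := fun h ↦ (hlt b h).not_gt hb
    simp [ofSet, hbs]
  · have := congrFun (congrArg val h) m
    simp [ofSet, hms, hm] at this

theorem not_strictMono_real (f : Profile → ℝ) : ¬ StrictMono f := by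
  classical
  intro hf
  let F : Set ℝ → ℝ := fun s ↦ if hs : s.IsWF then f (ofSet s hs) else 0
  let g : Ordinal.{0} → ℝ := Ordinal.lt_wf.fix
    fun α ih ↦ F (range fun β : Iio α ↦ ih β.1 β.2)
  have hg : ∀ α, g α = F (g '' Iio α) := by
    intro α
    rw [image_eq_range]
    exact Ordinal.lt_wf.fix_eq _ α
  have hmono : ∀ α, ∀ β < α, g β < g α := by
    intro α
    induction α using Ordinal.lt_wf.induction with
    | _ α ih =>
      intro β hβ
      have hwf : ∀ γ ≤ α, (g '' Iio γ).IsWF := by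
        intro γ hγ
        rw [isWF_iff_no_descending_seq]
        intro h hh hmem
        choose o ho hoh using hmem
        refine not_strictAnti_of_wellFoundedLT o fun m n hmn ↦ ?_
        by_contra hge
        have hlt := hh hmn
        rw [← hoh m, ← hoh n] at hlt
        rcases (not_lt.1 hge).eq_or_lt with h' | h'
        · exact hlt.ne' (congrArg g h')
        · exact hlt.not_gt (ih (o n) (lt_of_lt_of_le (ho n) hγ) (o m) h')
      rw [hg β, hg α]
      simp only [F, dif_pos (hwf β hβ.le), dif_pos (hwf α le_rfl)]
      refine hf (ofSet_lt_ofSet _ _ (image_mono (Iio_subset_Iio hβ.le)) (m := g β)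
        (mem_image_of_mem g hβ) ?_ ?_)
      · rintro _ ⟨γ, hγ, rfl⟩
        exact ih β hβ γ hγ
      · rintro _ ⟨γ, hγ, rfl⟩ hlt
        refine ⟨γ, mem_Iio.2 ?_, rfl⟩
        by_contra hge
        rcases (not_lt.1 hge).eq_or_lt with rfl | h
        · exact hlt.false
        · exact hlt.not_gt (ih γ hγ β h)
  exact not_injective_of_ordinal g (StrictMono.injective fun β α h ↦ hmono α β h)

end Profile

/-- There is a branchwise-real tree order admitting no strictly monotonic map
into ℝ; in particular it has no continuous grading. -/
theorem exists_brto_with_no_real_grading :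
    ∃ (X : Type 1) (_ : PartialOrder X),
      IsBRTO X ∧ (¬ ∃ f : X → ℝ, StrictMono f) ∧
        ¬ ∃ ℓ : X → ℝ, IsContinuousGrading ℓ := by
  refine ⟨Profile, inferInstance, Profile.isBRTO, ?_, ?_⟩
  · rintro ⟨f, hf⟩
    exact Profile.not_strictMono_real f hf
  · rintro ⟨ℓ, hℓ, -⟩
    exact Profile.not_strictMono_real ℓ hℓ
end

section
/- A branchwise-real tree order X is continuously gradable if and only if every well-stratified subtree T ⊆ X admits a strictly monotonic map into ℝ. -/
/-- A well-stratified subtree of a tree order: a subset in which every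
predecessor set (within the subset) is well-founded, hence (the ambient
predecessor sets being linear) well-ordered. -/
def IsWSSubtree {X : Type*} [PartialOrder X] (S : Set X) : Prop :=
  ∀ x ∈ S, Set.IsWF {y | y ∈ S ∧ y < x}

universe u

section

variable {X : Type u} [PartialOrder X]

theorem DownLinear.Iic_subset_of_isMaxChain (hX : DownLinear X) {B : Set X}
    (hB : IsMaxChain (· ≤ ·) B) {y : X} (hy : y ∈ B) : Set.Iic y ⊆ B := by
  intro w (hw : w ≤ y)
  have hc : IsChain (· ≤ ·) (insert w B) := by
    refine hB.1.insert fun v hv _ => ?_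
    rcases hB.1.total hv hy with h | h
    · exact hX y w v hw h
    · exact Or.inl (hw.trans h)
  rw [hB.2 hc (Set.subset_insert w B)]
  exact Set.mem_insert w B

theorem exists_isMaxChain_mem (x : X) : ∃ B : Set X, IsMaxChain (· ≤ ·) B ∧ x ∈ B := by
  obtain ⟨B, hB, hxB⟩ := (IsChain.singleton (r := (· ≤ ·)) (a := x)).exists_maxChain
  exact ⟨B, hB, hxB rfl⟩

/-- The closed intervals of a branchwise-real tree order are real intervals; here this is
recorded as a monotone parametrisation. -/
theorem IsBRTO.exists_monotone_param (hX : IsBRTO X) {x y : X} (hxy : x ≤ y) :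
    ∃ ψ : ℝ → X, Monotone ψ ∧ ∃ a b : ℝ, a ≤ b ∧ ψ a = x ∧ ψ b = y ∧
      Set.range ψ = Set.Icc x y ∧ Set.InjOn ψ (Set.Icc a b) := by
  obtain ⟨-, hD, hbr, -⟩ := hX
  obtain ⟨B, hB, hy⟩ := exists_isMaxChain_mem y
  have hsub := hD.Iic_subset_of_isMaxChain hB hy
  obtain ⟨I, hI, ⟨φ⟩⟩ := hbr B hB
  let x' : B := ⟨x, hsub hxy⟩
  let y' : B := ⟨y, hy⟩
  have hab : (φ x' : ℝ) ≤ φ y' := φ.monotone hxy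
  have hsubI : Set.Icc (φ x' : ℝ) (φ y') ⊆ I := hI.out (φ x').2 (φ y').2
  let ψ : ℝ → X := fun t => φ.symm ⟨_, hsubI (Set.projIcc _ _ hab t).2⟩
  have hψ : ∀ t (ht : t ∈ Set.Icc (φ x' : ℝ) (φ y')), ψ t = φ.symm ⟨t, hsubI ht⟩ := by
    intro t ht
    simp only [ψ, Set.projIcc_of_mem hab ht]
  have ha : ψ (φ x') = x := by
    rw [hψ _ ⟨le_rfl, hab⟩]
    simp [x']
  have hb : ψ (φ y') = y := by
    rw [hψ _ ⟨hab, le_rfl⟩]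
    simp [y']
  have hmono : Monotone ψ := fun s t hst =>
    φ.symm.monotone (Set.monotone_projIcc hab hst)
  refine ⟨ψ, hmono, φ x', φ y', hab, ha, hb, ?_, ?_⟩
  · apply Set.Subset.antisymm
    · rintro _ ⟨t, rfl⟩
      have h1 := (Set.projIcc _ _ hab t).2.1
      have h2 := (Set.projIcc _ _ hab t).2.2
      constructor
      · have : x' ≤ φ.symm ⟨_, hsubI (Set.projIcc _ _ hab t).2⟩ := by
          rw [OrderIso.le_symm_apply]
          exact h1
        exact this
      · have : φ.symm ⟨_, hsubI (Set.projIcc _ _ hab t).2⟩ ≤ y' := by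
          rw [OrderIso.symm_apply_le]
          exact h2
        exact this
    · rintro z ⟨hxz, hzy⟩
      let z' : B := ⟨z, hsub hzy⟩
      have hz : (φ z' : ℝ) ∈ Set.Icc (φ x' : ℝ) (φ y') := ⟨φ.monotone hxz, φ.monotone hzy⟩
      refine ⟨φ z', ?_⟩
      rw [hψ _ hz]
      simp [z']
  · intro s hs t ht hst
    rw [hψ s hs, hψ t ht] at hst
    exact congrArg Subtype.val (φ.symm.injective (Subtype.ext hst))

theorem IsBRTO.exists_between (hX : IsBRTO X) {x y : X} (hxy : x < y) :
    ∃ z, x < z ∧ z < y := by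
  obtain ⟨ψ, hmono, a, b, hab, rfl, rfl, -, hinj⟩ := hX.exists_monotone_param hxy.le
  have hlt : a < b := lt_of_le_of_ne hab (by rintro rfl; exact hxy.ne rfl)
  obtain ⟨c, hac, hcb⟩ := _root_.exists_between hlt
  have hc : c ∈ Set.Icc a b := ⟨hac.le, hcb.le⟩
  refine ⟨ψ c, lt_of_le_of_ne (hmono hac.le) fun h => ?_,
    lt_of_le_of_ne (hmono hcb.le) fun h => ?_⟩
  · exact hac.ne (hinj ⟨le_rfl, hab⟩ hc h)
  · exact hcb.ne (hinj hc ⟨hab, le_rfl⟩ h)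

/-- A layering of a tree order: along every chain the ordinal `layer` increases weakly, and the
points of a chain lying in a single layer are parametrised by an interval of real heights. -/
structure Layering (X : Type u) [PartialOrder X] where
  layer : X → Ordinal.{u}
  height : X → ℝ
  layer_mono : Monotone layer
  height_lt : ∀ {x y}, x < y → layer x = layer y → height x < height y
  exists_height_eq : ∀ {x y}, x ≤ y → layer x = layer y →
    ∀ c ∈ Set.Icc (height x) (height y), ∃ z ∈ Set.Icc x y, height z = c
  abs_height_le : ∀ x, |height x| ≤ 2

/-- Well-order the branches, and let the layer of a point be the least branch containing it. -/
theorem IsBRTO.nonempty_layering (hX : IsBRTO X) :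
    Nonempty (Layering X) := by
  have hD := hX.2.1
  have hbr := hX.2.2.1
  let g : Set X → Ordinal.{u} := Ordinal.typein WellOrderingRel
  have hg : Function.Injective g := Ordinal.typein_injective _
  let S : X → Set Ordinal := fun x => {o | ∃ B, IsMaxChain (· ≤ ·) B ∧ x ∈ B ∧ g B = o}
  have hS : ∀ x, (S x).Nonempty := fun x =>
    let ⟨B, hB, hx⟩ := exists_isMaxChain_mem x
    ⟨g B, B, hB, hx, rfl⟩
  let β : X → Ordinal := fun x => sInf (S x)
  choose B hB hxB hgB using fun x => (csInf_mem (hS x) : β x ∈ S x)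
  have hφ : ∀ B : Set X, IsMaxChain (· ≤ ·) B → ∃ φ : X → ℝ, StrictMonoOn φ B ∧
      (φ '' B).OrdConnected ∧ ∀ x, |φ x| ≤ 2 := by
    intro B hB
    obtain ⟨I, hI, ⟨φ⟩⟩ := hbr B hB
    classical
    let φ' : X → ℝ := fun x => if h : x ∈ B then Real.arctan (φ ⟨x, h⟩) else 0
    have hφ' : ∀ x (h : x ∈ B), φ' x = Real.arctan (φ ⟨x, h⟩) := fun x h => dif_pos h
    refine ⟨φ', ?_, ?_, ?_⟩
    · intro x hx y hy hxy
      rw [hφ' x hx, hφ' y hy]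
      exact Real.arctan_strictMono (φ.strictMono (show (⟨x, hx⟩ : B) < ⟨y, hy⟩ from hxy))
    · have : φ' '' B = Real.arctan '' I := by
        ext t
        constructor
        · rintro ⟨x, hx, rfl⟩
          exact ⟨φ ⟨x, hx⟩, (φ ⟨x, hx⟩).2, (hφ' x hx).symm⟩
        · rintro ⟨s, hs, rfl⟩
          refine ⟨φ.symm ⟨s, hs⟩, (φ.symm ⟨s, hs⟩).2, ?_⟩
          rw [hφ' _ (φ.symm ⟨s, hs⟩).2]
          simp
      rw [this]
      exact (hI.isPreconnected.image _ Real.continuous_arctan.continuousOn).ordConnected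
    · intro x
      have hpi := Real.pi_lt_four
      by_cases h : x ∈ B
      · rw [hφ' x h, abs_le]
        have h1 := Real.neg_pi_div_two_lt_arctan (φ ⟨x, h⟩)
        have h2 := Real.arctan_lt_pi_div_two (φ ⟨x, h⟩)
        constructor <;> linarith
      · simp [φ', h]
  choose! φ hφm hφc hφb using hφ
  have hmono : ∀ {x y}, x ≤ y → β x ≤ β y := by
    intro x y hxy
    refine csInf_le_csInf (OrderBot.bddBelow _) (hS y) ?_
    rintro _ ⟨C, hC, hyC, rfl⟩
    exact ⟨C, hC, hD.Iic_subset_of_isMaxChain hC hyC hxy, rfl⟩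
  have hBeq : ∀ {x y}, β x = β y → B x = B y := fun {x y} h =>
    hg ((hgB x).trans (h.trans (hgB y).symm))
  refine ⟨{ layer := β, height := fun x => φ (B x) x, layer_mono := fun _ _ => hmono, height_lt := ?_,
            exists_height_eq := ?_, abs_height_le := fun x => hφb _ (hB x) x }⟩
  · intro x y hxy h
    have hx := hxB x
    simp only [hBeq h] at hx ⊢
    exact hφm _ (hB y) hx (hxB y) hxy
  · intro x y hxy h c hc
    have hx := hxB x
    simp only [hBeq h] at hx hc ⊢
    obtain ⟨z, hz, rfl⟩ := (hφc _ (hB y)).out ⟨x, hx, rfl⟩ ⟨y, hxB y, rfl⟩ hc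
    have hm : StrictMonoOn (φ (B y)) (B y) := hφm _ (hB y)
    have hle : ∀ {u v}, u ∈ B y → v ∈ B y → φ (B y) u ≤ φ (B y) v → u ≤ v := by
      intro u v hu hv huv
      rcases (hB y).1.total hu hv with h' | h'
      · exact h'
      · rcases h'.eq_or_lt with rfl | h'
        · exact le_rfl
        · exact absurd (hm hv hu h') huv.not_gt
    have hxz := hle hx hz hc.1
    have hzy := hle hz (hxB y) hc.2
    refine ⟨z, ⟨hxz, hzy⟩, ?_⟩
    rw [hBeq (le_antisymm (hmono hzy) (h ▸ hmono hxz) : β z = β y)]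

namespace Layering

variable (L : Layering X)

theorem layer_lt_of_height_eq {x y : X} (hxy : x < y) (h : L.height x = L.height y) :
    L.layer x < L.layer y :=
  lt_of_le_of_ne (L.layer_mono hxy.le) fun hl => (L.height_lt hxy hl).ne h

theorem isWF_height_eq (q : ℝ) : Set.IsWF {y | L.height y = q} := by
  refine Subrelation.wf ?_ (InvImage.wf
    (fun y : {y | L.height y = q} => L.layer y.1) Ordinal.lt_wf)
  intro y z hyz
  exact L.layer_lt_of_height_eq hyz (y.2.trans z.2.symm)

theorem isWSSubtree_height (q r : ℝ) : IsWSSubtree {x | L.height x = q ∨ L.height x = r} :=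
  fun _ _ => ((L.isWF_height_eq q).union (L.isWF_height_eq r)).mono fun _ hy => hy.1

theorem height_le {x y : X} (hxy : x ≤ y) (h : L.layer x = L.layer y) :
    L.height x ≤ L.height y := by
  rcases hxy.eq_or_lt with rfl | hlt
  · exact le_rfl
  · exact (L.height_lt hlt h).le

theorem exists_lt_layer_eq (hX : IsBRTO X) {x y : X} (hxy : x < y) :
    ∃ u v, x ≤ u ∧ u < v ∧ v ≤ y ∧ L.layer u = L.layer v := by
  by_contra! h
  obtain ⟨_, ⟨m, hm, rfl⟩, hmin⟩ := Ordinal.lt_wf.has_min (L.layer '' Set.Ioc x y)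
    ⟨_, y, ⟨hxy, le_rfl⟩, rfl⟩
  obtain ⟨z, hxz, hzm⟩ := hX.exists_between hm.1
  refine hmin _ ⟨z, ⟨hxz, hzm.le.trans hm.2⟩, rfl⟩ ?_
  exact lt_of_le_of_ne (L.layer_mono hzm.le) (h z m hxz.le hzm hm.2)

/-- The points lying weakly above the height-`r` point `d` of their layer, where that layer has a
point `c < d` of height `q` with `f c < s < f d`. -/
def active (f : X → ℝ) (q r s : ℝ) : Set X :=
  {z | ∃ c d, c < d ∧ L.layer c = L.layer d ∧ L.height c = q ∧ L.height d = r ∧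
    f c < s ∧ s < f d ∧ d ≤ z ∧ L.layer d = L.layer z}

/-- The distance climbed above height `r` by active points below a given one. -/
noncomputable def bump (f : X → ℝ) (q r s : ℝ) (y : X) : ℝ :=
  sSup (insert 0 ((fun z => L.height z - r) '' (L.active f q r s ∩ Set.Iic y)))

variable {f : X → ℝ} {q r s : ℝ}

theorem layer_eq_of_mem_active (hD : DownLinear X)
    (hf : StrictMonoOn f {x | L.height x = q ∨ L.height x = r}) {x y z : X}
    (hx : x ∈ L.active f q r s) (hy : y ∈ L.active f q r s) (hxz : x ≤ z) (hyz : y ≤ z) :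
    L.layer x = L.layer y := by
  have key : ∀ {x y : X}, x ∈ L.active f q r s → y ∈ L.active f q r s → x ≤ z → y ≤ z →
      L.layer y ≤ L.layer x := by
    rintro x y ⟨-, d, -, -, -, hd, -, hsd, hdx, hdl⟩ ⟨c, d', hcd, hcl, hc, -, hcs, -, hdy, hdl'⟩
      hxz hyz
    rw [← hdl, ← hdl', ← hcl]
    rcases hD z c d ((hcd.le.trans hdy).trans hyz) (hdx.trans hxz) with h | h
    · exact L.layer_mono h
    · exact absurd (hf.monotoneOn (Or.inr hd) (Or.inl hc) h) (hcs.trans hsd).not_ge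
  exact le_antisymm (key hy hx hyz hxz) (key hx hy hxz hyz)

theorem height_sub_le_four {z : X} (hz : z ∈ L.active f q r s) : L.height z - r ≤ 4 := by
  obtain ⟨-, d, -, -, -, rfl, -⟩ := hz
  linarith [(abs_le.1 (L.abs_height_le z)).2, (abs_le.1 (L.abs_height_le d)).1]

theorem four_mem_upperBounds (y : X) : (4 : ℝ) ∈ upperBounds
    (insert 0 ((fun z => L.height z - r) '' (L.active f q r s ∩ Set.Iic y))) := by
  rintro _ (rfl | ⟨z, hz, rfl⟩)
  · norm_num
  · exact L.height_sub_le_four hz.1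

theorem bump_nonneg (y : X) : 0 ≤ L.bump f q r s y :=
  le_csSup ⟨4, L.four_mem_upperBounds y⟩ (Set.mem_insert _ _)

theorem bump_le_four (y : X) : L.bump f q r s y ≤ 4 :=
  csSup_le (Set.insert_nonempty _ _) (L.four_mem_upperBounds y)

theorem bump_mono : Monotone (L.bump f q r s) := fun _ y hxy =>
  csSup_le_csSup ⟨4, L.four_mem_upperBounds y⟩ (Set.insert_nonempty _ _)
    (Set.insert_subset_insert (Set.image_mono
      (Set.inter_subset_inter_right _ (Set.Iic_subset_Iic.2 hxy))))

theorem bump_eq (hD : DownLinear X)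
    (hf : StrictMonoOn f {x | L.height x = q ∨ L.height x = r}) {z : X}
    (hz : z ∈ L.active f q r s) : L.bump f q r s z = L.height z - r := by
  refine le_antisymm (csSup_le (Set.insert_nonempty _ _) ?_)
    (le_csSup ⟨4, L.four_mem_upperBounds z⟩ (Or.inr ⟨z, ⟨hz, le_rfl⟩, rfl⟩))
  rintro _ (rfl | ⟨w, ⟨hw, hwz⟩, rfl⟩)
  · obtain ⟨-, d, -, -, -, rfl, -, -, hdz, hdl⟩ := hz
    exact sub_nonneg.2 (L.height_le hdz hdl)
  · exact sub_le_sub_right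
      (L.height_le hwz (L.layer_eq_of_mem_active hD hf hw hz hwz le_rfl)) r

theorem exists_bump_eq (hD : DownLinear X)
    (hf : StrictMonoOn f {x | L.height x = q ∨ L.height x = r}) {x y : X} (hxy : x ≤ y) {c : ℝ}
    (hc : c ∈ Set.Icc (L.bump f q r s x) (L.bump f q r s y)) :
    ∃ z ∈ Set.Icc x y, L.bump f q r s z = c := by
  rcases hc.1.eq_or_lt with h | hxc
  · exact ⟨x, ⟨le_rfl, hxy⟩, h⟩
  rcases hc.2.eq_or_lt with h | hcy
  · exact ⟨y, ⟨hxy, le_rfl⟩, h.symm⟩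
  have hc0 : 0 ≤ c := (L.bump_nonneg x).trans hxc.le
  obtain ⟨_, rfl | ⟨z, ⟨hz, hzy⟩, rfl⟩, hcz⟩ := exists_lt_of_lt_csSup (Set.insert_nonempty _ _) hcy
  · exact absurd hcz hc0.not_gt
  obtain ⟨b, d, hbd, hbl, hb, hd, hbs, hsd, hdz, hdl⟩ := hz
  obtain ⟨w, ⟨hdw, hwz⟩, hw⟩ := L.exists_height_eq hdz hdl (c + r)
    ⟨by linarith, by dsimp only at hcz; linarith⟩
  have hwl : L.layer d = L.layer w :=
    le_antisymm (L.layer_mono hdw) (hdl ▸ L.layer_mono hwz)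
  have hwc : L.bump f q r s w = c := by
    rw [L.bump_eq hD hf ⟨b, d, hbd, hbl, hb, hd, hbs, hsd, hdw, hwl⟩, hw, add_sub_cancel_right]
  refine ⟨w, ⟨?_, hwz.trans hzy⟩, hwc⟩
  rcases hD y x w hxy (hwz.trans hzy) with h | h
  · exact h
  · exact absurd (L.bump_mono h) (hwc ▸ hxc).not_ge

theorem exists_bump_lt (hX : IsBRTO X) {F : ℚ → ℚ → X → ℝ}
    (hF : ∀ q r, StrictMonoOn (F q r) {x | L.height x = q ∨ L.height x = r}) {x y : X}
    (hxy : x < y) : ∃ q r s : ℚ, L.bump (F q r) q r s x < L.bump (F q r) q r s y := by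
  have hD := hX.2.1
  obtain ⟨u, v, hxu, huv, hvy, hl⟩ := L.exists_lt_layer_eq hX hxy
  obtain ⟨q, huq, hqv⟩ := exists_rat_btwn (L.height_lt huv hl)
  obtain ⟨r, hqr, hrv⟩ := exists_rat_btwn hqv
  obtain ⟨c, ⟨huc, hcv⟩, hc⟩ := L.exists_height_eq huv.le hl q ⟨huq.le, hqv.le⟩
  obtain ⟨d, ⟨hud, hdv⟩, hd⟩ := L.exists_height_eq huv.le hl r ⟨(huq.trans hqr).le, hrv.le⟩
  have hcl : L.layer c = L.layer v :=
    le_antisymm (L.layer_mono hcv) (hl ▸ L.layer_mono huc)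
  have hdl : L.layer d = L.layer v :=
    le_antisymm (L.layer_mono hdv) (hl ▸ L.layer_mono hud)
  have hcd : c < d := by
    refine lt_of_le_not_ge ((hD v c d hcv hdv).resolve_right fun h => ?_) fun h => ?_ <;>
    · have := L.height_le h (hdl.trans hcl.symm)
      linarith
  obtain ⟨s, hcs, hsd⟩ := exists_rat_btwn (hF q r (Or.inl hc) (Or.inr hd) hcd)
  have hv : v ∈ L.active (F q r) q r s :=
    ⟨c, d, hcd, hcl.trans hdl.symm, hc, hd, hcs, hsd, hdv, hdl⟩
  refine ⟨q, r, s, ?_⟩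
  calc L.bump (F q r) q r s x ≤ 0 := ?_
    _ < L.height v - r := sub_pos.2 hrv
    _ = L.bump (F q r) q r s v := (L.bump_eq hD (hF q r) hv).symm
    _ ≤ _ := L.bump_mono hvy
  refine csSup_le (Set.insert_nonempty _ _) ?_
  rintro _ (rfl | ⟨w, ⟨⟨-, d', -, -, -, hd', -, hsd', hdw, -⟩, hwx⟩, rfl⟩)
  · exact le_rfl
  · have hle : d' ≤ c := ((hdw.trans hwx).trans hxu).trans huc
    exact absurd ((hF q r).monotoneOn (Or.inr hd') (Or.inl hc) hle) (hcs.trans hsd').not_ge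

end Layering

/-- A monotone map with the intermediate value property is continuous along every monotone
parametrisation of an interval. -/
theorem Monotone.continuous_comp_of_range_eq_Icc {h : X → ℝ} (hm : Monotone h) {x y : X}
    (hiv : ∀ c ∈ Set.Icc (h x) (h y), ∃ z ∈ Set.Icc x y, h z = c) {ψ : ℝ → X}
    (hψ : Monotone ψ) (hr : Set.range ψ = Set.Icc x y) : Continuous (h ∘ ψ) := by
  have hmem : ∀ t, ψ t ∈ Set.Icc x y := fun t => hr ▸ Set.mem_range_self t
  let g : ℝ → Set.Icc (h x) (h y) := fun t => ⟨h (ψ t), hm (hmem t).1, hm (hmem t).2⟩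
  have hg : Monotone g := fun _ _ hst => hm (hψ hst)
  have hsurj : Function.Surjective g := by
    rintro ⟨c, hc⟩
    obtain ⟨z, hz, rfl⟩ := hiv c hc
    obtain ⟨t, rfl⟩ : z ∈ Set.range ψ := hr ▸ hz
    exact ⟨t, rfl⟩
  exact continuous_subtype_val.comp (hg.continuous_of_surjective hsurj)

theorem IsBRTO.isContinuousGrading_tsum (hX : IsBRTO X) {ι : Type*} {h : ι → X → ℝ} {w : ι → ℝ}
    (hw : Summable w) (h0 : ∀ i x, 0 ≤ h i x) (hb : ∀ i x, h i x ≤ w i)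
    (hm : ∀ i, Monotone (h i))
    (hiv : ∀ i x y, x ≤ y → ∀ c ∈ Set.Icc (h i x) (h i y), ∃ z ∈ Set.Icc x y, h i z = c)
    (hlt : ∀ x y, x < y → ∃ i, h i x < h i y) :
    IsContinuousGrading fun x => ∑' i, h i x := by
  have hs : ∀ x, Summable fun i => h i x := fun x =>
    Summable.of_nonneg_of_le (h0 · x) (hb · x) hw
  have hmono : StrictMono fun x => ∑' i, h i x := by
    intro x y hxy
    obtain ⟨i, hi⟩ := hlt x y hxy
    exact (hs x).tsum_lt_tsum (fun j => hm j hxy.le) hi (hs y)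
  refine ⟨hmono, fun x y hxy => ⟨fun z hz => ⟨hmono.monotone hz.1, hmono.monotone hz.2⟩, ?_, ?_⟩⟩
  · intro u hu v hv huv
    rcases hX.2.1 y u v hu.2 hv.2 with h' | h'
    · exact h'.eq_or_lt.resolve_right fun h' => (hmono h').ne huv
    · exact (h'.eq_or_lt.resolve_right fun h' => (hmono h').ne huv.symm).symm
  · obtain ⟨ψ, hψ, a, b, hab, rfl, rfl, hr, -⟩ := hX.exists_monotone_param hxy.le
    have hc : Continuous fun t => ∑' i, h i (ψ t) :=
      continuous_tsum (fun i => (hm i).continuous_comp_of_range_eq_Icc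
        (hiv i _ _ hxy.le) hψ hr) hw fun i t => by
          rw [Real.norm_of_nonneg (h0 i _)]
          exact hb i _
    intro c hcm
    obtain ⟨t, -, ht⟩ := intermediate_value_Icc hab hc.continuousOn hcm
    exact ⟨ψ t, hr ▸ Set.mem_range_self t, ht⟩

theorem IsBRTO.exists_isContinuousGrading (hX : IsBRTO X)
    (hT : ∀ T : Set X, IsWSSubtree T → ∃ f : T → ℝ, StrictMono f) :
    ∃ ℓ : X → ℝ, IsContinuousGrading ℓ := by
  classical
  obtain ⟨L⟩ := hX.nonempty_layering
  have hF : ∀ q r : ℚ, ∃ f : X → ℝ, StrictMonoOn f {x | L.height x = q ∨ L.height x = r} := by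
    intro q r
    obtain ⟨f, hf⟩ := hT _ (L.isWSSubtree_height q r)
    refine ⟨fun x => if hx : L.height x = q ∨ L.height x = r then f ⟨x, hx⟩ else 0, ?_⟩
    intro x (hx : _ ∨ _) y (hy : _ ∨ _) hxy
    simp only [dif_pos hx, dif_pos hy]
    exact hf hxy
  choose F hF using hF
  let h : ℚ × ℚ × ℚ → X → ℝ := fun i => L.bump (F i.1 i.2.1) i.1 i.2.1 i.2.2
  let w : ℚ × ℚ × ℚ → ℝ := fun i => (1 / 2) ^ Encodable.encode i
  have hw : ∀ i, 0 < w i := fun i => by positivity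
  refine ⟨_, hX.isContinuousGrading_tsum (h := fun i x => w i * h i x)
    (summable_geometric_two_encode.mul_right 4)
    (fun i x => mul_nonneg (hw i).le (L.bump_nonneg x))
    (fun i x => mul_le_mul_of_nonneg_left (L.bump_le_four x) (hw i).le)
    (fun i => L.bump_mono.const_mul (hw i).le) ?_ ?_⟩
  · rintro i x y hxy c ⟨hxc, hcy⟩
    obtain ⟨z, hz, hzc⟩ := L.exists_bump_eq hX.2.1 (hF i.1 i.2.1) (s := i.2.2) hxy (c := c / w i)
      ⟨(le_div_iff₀' (hw i)).2 hxc, (div_le_iff₀' (hw i)).2 hcy⟩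
    exact ⟨z, hz, by simp only [h, hzc]; exact mul_div_cancel₀ c (hw i).ne'⟩
  · intro x y hxy
    obtain ⟨q, r, s, hlt⟩ := L.exists_bump_lt hX hF hxy
    exact ⟨(q, r, s), mul_lt_mul_of_pos_left hlt (hw _)⟩

end

/-- A branchwise-real tree order is continuously gradable iff every
well-stratified subtree admits a strictly monotonic map into ℝ. -/
theorem brto_continuously_gradable_iff_subtrees_gradable (X : Type*)
    [PartialOrder X] (hX : IsBRTO X) :
    (∃ ℓ : X → ℝ, IsContinuousGrading ℓ) ↔
      ∀ T : Set X, IsWSSubtree T → ∃ f : T → ℝ, StrictMono f := by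
  exact ⟨fun ⟨ℓ, hℓ⟩ _ _ => ⟨fun x => ℓ x, fun _ _ hxy => hℓ.1 hxy⟩,
    hX.exists_isContinuousGrading⟩
end

section
/- Every ccc branchwise-real tree order with no continuous grading contains a Suslin tree as a well-stratified subtree. -/
theorem exists_cofinal_wellFoundedOn_lt (X : Type*) [PartialOrder X] :
    ∃ T : Set X, T.IsWF ∧ ∀ x, ∃ y ∈ T, x ≤ y := by
  let r : X → X → Prop := WellOrderingRel
  have hr : WellFounded r := IsWellFounded.wf
  refine ⟨{x | ∀ y, r y x → ¬ x < y}, ?_, fun x => ?_⟩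
  · refine Set.WellFoundedOn.mono' (r := r) ?_ (hr.wellFoundedOn)
    intro a ha b hb hab
    rcases trichotomous_of WellOrderingRel a b with h | h | h
    · exact h
    · exact absurd h hab.ne
    · exact absurd hab (ha b h)
  · obtain ⟨y, hxy, hy⟩ := hr.has_min (Set.Ici x) ⟨x, le_refl x⟩
    exact ⟨y, fun z hz hyz => hy z (le_trans hxy hyz.le) hz, hxy⟩

theorem StrictMonoOn.le_of_map_le {α β : Type*} [PartialOrder α] [Preorder β] {f : α → β}
    {s : Set α} (hf : StrictMonoOn f s) (hs : IsChain (· ≤ ·) s) {a b : α} (ha : a ∈ s)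
    (hb : b ∈ s) (h : f a ≤ f b) : a ≤ b := by
  rcases hs.total ha hb with hab | hba
  · exact hab
  · rcases hba.eq_or_lt with rfl | hba
    · exact le_rfl
    · exact absurd (hf hb ha hba) h.not_gt

theorem StrictMonoOn.injOn_of_isChain {α β : Type*} [PartialOrder α] [Preorder β] {f : α → β}
    {s : Set α} (hf : StrictMonoOn f s) (hs : IsChain (· ≤ ·) s) : Set.InjOn f s :=
  fun _ ha _ hb h =>
    le_antisymm (hf.le_of_map_le hs ha hb h.le) (hf.le_of_map_le hs hb ha h.ge)

theorem IsBRTO.isChain_Iic {X : Type*} [PartialOrder X] (hX : IsBRTO X) (b : X) :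
    IsChain (· ≤ ·) (Set.Iic b) :=
  fun _ hx _ hy _ => hX.2.1 b _ _ hx hy

theorem IsBRTO.exists_strictMonoOn_surjOn {X : Type*} [PartialOrder X] (hX : IsBRTO X) {C : Set X}
    (hC : IsChain (· ≤ ·) C) :
    ∃ f : X → ℝ, StrictMonoOn f C ∧ ∀ x ∈ C, ∀ y ∈ C,
      Set.SurjOn f (Set.Icc x y) (Set.Icc (f x) (f y)) := by
  classical
  obtain ⟨B, hB, hCB⟩ := hC.exists_maxChain
  obtain ⟨I, hI, ⟨e⟩⟩ := hX.2.2.1 B hB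
  have hf (z : X) (hz : z ∈ B) :
      (if h : z ∈ B then (e ⟨z, h⟩ : ℝ) else 0) = e ⟨z, hz⟩ := dif_pos hz
  refine ⟨fun z => if h : z ∈ B then (e ⟨z, h⟩ : ℝ) else 0, ?_, ?_⟩
  · intro x hx y hy hxy
    simp only [hf x (hCB hx), hf y (hCB hy)]
    exact e.strictMono hxy
  · intro x hx y hy c hc
    simp only [hf x (hCB hx), hf y (hCB hy)] at hc
    have hcI : c ∈ I := hI.out (e _).2 (e _).2 hc
    have hez : (e (e.symm ⟨c, hcI⟩) : ℝ) = c := by simp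
    refine ⟨e.symm ⟨c, hcI⟩, ⟨?_, ?_⟩, ?_⟩
    · exact (e.le_symm_apply (x := ⟨x, hCB hx⟩)).2 hc.1
    · exact (e.symm_apply_le (x := ⟨y, hCB hy⟩)).2 hc.2
    · exact (hf _ (e.symm ⟨c, hcI⟩).2).trans hez

theorem IsBRTO.exists_bounded_monotone {X : Type*} [PartialOrder X] (hX : IsBRTO X) (b : X) :
    ∃ g : X → ℝ, Monotone g ∧ (∀ x, g x ∈ Set.Icc 0 1) ∧ StrictMonoOn g (Set.Iic b) ∧
      ∀ x y, x ≤ y → Set.SurjOn g (Set.Icc x y) (Set.Icc (g x) (g y)) := by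
  obtain ⟨r, hr⟩ := hX.1
  choose m hm using hX.2.2.2
  obtain ⟨f, hf, hsurj⟩ := hX.exists_strictMonoOn_surjOn (hX.isChain_Iic b)
  have hm_left (x y) : m x y ≤ x := (hm x y).1 (by simp)
  have hm_right (x y) : m x y ≤ y := (hm x y).1 (by simp)
  have le_m {x y z} (hx : z ≤ x) (hy : z ≤ y) : z ≤ m x y := (hm x y).2 (by simp [hx, hy])
  have hm_mono {x y} (h : x ≤ y) : m x b ≤ m y b :=
    le_m ((hm_left _ _).trans h) (hm_right _ _)
  have hm_eq {x} (h : x ≤ b) : m x b = x := le_antisymm (hm_left _ _) (le_m le_rfl h)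
  have hfr : f r ≤ f b := hf.monotoneOn (hr b) (le_refl b) (hr b)
  have hpos : 0 < f b - f r + 1 := by linarith
  refine ⟨fun x => (f (m x b) - f r) / (f b - f r + 1), ?_, ?_, ?_, ?_⟩
  · intro x y hxy
    have := hf.monotoneOn (hm_right x b) (hm_right y b) (hm_mono hxy)
    dsimp only
    gcongr
  · intro x
    have h₀ := hf.monotoneOn (hr b) (hm_right x b) (hr _)
    have h₁ := hf.monotoneOn (hm_right x b) (le_refl b) (hm_right x b)
    exact ⟨div_nonneg (by linarith) hpos.le, (div_le_one hpos).2 (by linarith)⟩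
  · intro x hx y hy hxy
    have := hf hx hy hxy
    dsimp only
    rw [hm_eq hx, hm_eq hy]
    gcongr
  · intro x y hxy c hc
    have hc₁ := (div_le_iff₀ hpos).1 hc.1
    have hc₂ := (le_div_iff₀ hpos).1 hc.2
    obtain ⟨w, ⟨hxw, hwy⟩, hw⟩ := hsurj (m x b) (hm_right _ _) (m y b) (hm_right _ _)
      (show c * (f b - f r + 1) + f r ∈ _ from ⟨by linarith, by linarith⟩)
    have hwb : w ≤ b := hwy.trans (hm_right _ _)
    rcases hX.2.1 y x w hxy (hwy.trans (hm_left _ _)) with h | h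
    · refine ⟨w, ⟨h, hwy.trans (hm_left _ _)⟩, ?_⟩
      dsimp only
      rw [hm_eq hwb, hw, div_eq_iff hpos.ne']
      ring
    · refine ⟨x, ⟨le_rfl, hxy⟩, ?_⟩
      dsimp only
      rw [le_antisymm hxw (le_m h hwb), hw, div_eq_iff hpos.ne']
      ring

theorem IsBRTO.exists_continuousGrading_of_countable_cofinal {X : Type*} [PartialOrder X]
    (hX : IsBRTO X) {T : Set X} (hT : T.Countable) (hcof : ∀ x, ∃ y ∈ T, x ≤ y) :
    ∃ ℓ : X → ℝ, IsContinuousGrading ℓ := by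
  obtain ⟨r, hr⟩ := hX.1
  obtain ⟨b, rfl⟩ := hT.exists_eq_range ((hcof r).imp fun _ h => h.1)
  choose g hmono hbdd hstrict hsurj using fun n => hX.exists_bounded_monotone (b n)
  have hle (n : ℕ) (x : X) : (1 / 2 : ℝ) ^ n * g n x ≤ (1 / 2) ^ n :=
    mul_le_of_le_one_right (by positivity) (hbdd n x).2
  have hnonneg (n : ℕ) (x : X) : 0 ≤ (1 / 2 : ℝ) ^ n * g n x :=
    mul_nonneg (by positivity) (hbdd n x).1
  have hsum (x : X) : Summable fun n => (1 / 2 : ℝ) ^ n * g n x :=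
    Summable.of_nonneg_of_le (hnonneg · x) (hle · x) summable_geometric_two
  have hlt : StrictMono fun x => ∑' n, (1 / 2 : ℝ) ^ n * g n x := by
    intro x y hxy
    obtain ⟨_, ⟨n, rfl⟩, hn⟩ := hcof y
    refine Summable.tsum_lt_tsum (i := n) (fun k => ?_) ?_ (hsum x) (hsum y)
    · have := hmono k hxy.le
      gcongr
    · have := hstrict n (hxy.le.trans hn) hn hxy
      gcongr
  refine ⟨_, hlt, fun x y hxy => ⟨?_, (hlt.strictMonoOn _).injOn_of_isChain
    ((hX.isChain_Iic y).mono fun _ hz => hz.2), ?_⟩⟩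
  · exact fun z hz => ⟨hlt.monotone hz.1, hlt.monotone hz.2⟩
  intro c hc
  obtain ⟨f, hf, hfsurj⟩ := hX.exists_strictMonoOn_surjOn (hX.isChain_Iic y)
  choose ψ hψ hfψ using fun t : Set.Icc (f x) (f y) =>
    hfsurj x hxy.le y (le_refl y) t.2
  have hψf (z : X) (hz : z ∈ Set.Icc x y) : ∃ t, ψ t = z :=
    ⟨⟨f z, hf.monotoneOn hxy.le hz.2 hz.1, hf.monotoneOn hz.2 (le_refl y) hz.2⟩,
      hf.injOn_of_isChain (hX.isChain_Iic y) (hψ _).2 hz.2 (hfψ _)⟩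
  have hψmono : Monotone ψ := fun s t hst =>
    hf.le_of_map_le (hX.isChain_Iic y) (hψ s).2 (hψ t).2 (by rw [hfψ, hfψ]; exact hst)
  have hcont (n : ℕ) : Continuous fun t => g n (ψ t) := by
    let G (t : Set.Icc (f x) (f y)) : Set.Icc (g n x) (g n y) :=
      ⟨g n (ψ t), hmono n (hψ t).1, hmono n (hψ t).2⟩
    have hG : Continuous G := by
      refine Monotone.continuous_of_surjective (fun s t hst => hmono n (hψmono hst)) fun d => ?_
      obtain ⟨z, hz, hzd⟩ := hsurj n x y hxy.le d.2
      obtain ⟨t, rfl⟩ := hψf z hz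
      exact ⟨t, Subtype.ext hzd⟩
    exact continuous_subtype_val.comp hG
  have hsumcont : Continuous fun t => ∑' n, (1 / 2 : ℝ) ^ n * g n (ψ t) :=
    continuous_tsum (fun n => (hcont n).const_mul _) summable_geometric_two fun n t => by
      rw [Real.norm_of_nonneg (hnonneg n _)]
      exact hle n _
  have : PreconnectedSpace (Set.Icc (f x) (f y)) :=
    Subtype.preconnectedSpace isPreconnected_Icc
  obtain ⟨s, hs⟩ := hψf x ⟨le_rfl, hxy.le⟩
  obtain ⟨t, ht⟩ := hψf y ⟨hxy.le, le_rfl⟩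
  obtain ⟨u, hu⟩ := intermediate_value_univ s t hsumcont (by simpa only [hs, ht] using hc)
  exact ⟨ψ u, hψ u, hu⟩

theorem Set.IsWF.countable_real_s18 {S : Set ℝ} (hS : S.IsWF) : S.Countable := by
  have hsucc (x : ℝ) : ∃ y, x < y ∧ ∀ b ∈ S, x < b → y ≤ b := by
    by_cases hx : (S ∩ Set.Ioi x).Nonempty
    · have hwf := hS.mono (Set.inter_subset_left (t := Set.Ioi x))
      exact ⟨hwf.min hx, (hwf.min_mem hx).2, fun b hb hxb => hwf.min_le hx ⟨hb, hxb⟩⟩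
    · exact ⟨x + 1, by linarith, fun b hb hxb => absurd ⟨b, hb, hxb⟩ hx⟩
  choose y hy hyle using hsucc
  refine Set.PairwiseDisjoint.countable_of_Ioo (y := y) ?_ fun x _ => hy x
  intro a ha b hb hab
  refine Set.disjoint_left.2 fun z hza hzb => ?_
  rcases hab.lt_or_gt with h | h
  · exact absurd (hyle a b hb h) (not_le.2 (hzb.1.trans hza.2))
  · exact absurd (hyle b a ha h) (not_le.2 (hza.1.trans hzb.2))

theorem IsBRTO.countable_of_isChain_of_isWF {X : Type*} [PartialOrder X] (hX : IsBRTO X)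
    {C : Set X} (hC : IsChain (· ≤ ·) C) (hwf : C.IsWF) : C.Countable := by
  obtain ⟨f, hf, -⟩ := hX.exists_strictMonoOn_surjOn hC
  have himage : (f '' C).IsWF := by
    refine Set.wellFoundedOn_image.2 (hwf.mono' fun a ha b hb (h : f a < f b) => ?_)
    exact lt_of_le_of_ne (hf.le_of_map_le hC ha hb h.le) fun hne => h.ne (congrArg f hne)
  exact Set.countable_of_injective_of_countable_image (hf.injOn_of_isChain hC)
    himage.countable_real_s18

/-- Every ccc branchwise-real tree order with no continuous grading contains
a Suslin tree as a well-stratified subtree: an uncountable well-stratified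
subtree all of whose chains and antichains are countable. -/
theorem ccc_brto_no_grading_contains_suslin (X : Type*) [PartialOrder X]
    (hX : IsBRTO X)
    (hcc : ∀ A : Set X, IsAntichain (· ≤ ·) A → A.Countable)
    (hng : ¬ ∃ ℓ : X → ℝ, IsContinuousGrading ℓ) :
    ∃ T : Set X, IsWSSubtree T ∧ ¬ T.Countable ∧
      (∀ C ⊆ T, IsChain (· ≤ ·) C → C.Countable) ∧
      (∀ A ⊆ T, IsAntichain (· ≤ ·) A → A.Countable) := by
  obtain ⟨T, hwf, hcof⟩ := exists_cofinal_wellFoundedOn_lt X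
  refine ⟨T, fun x _ => hwf.mono fun y hy => hy.1, fun hT => ?_, fun C hCT hC => ?_,
    fun A _ hA => hcc A hA⟩
  · exact hng (hX.exists_continuousGrading_of_countable_cofinal hT hcof)
  · exact hX.countable_of_isChain_of_isWF hC (hwf.mono hCT)
end
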